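/- arXiv:2503.20773 — 2 statements merged into one kernel-verified Lean document; each statement's English description precedes it below -/
import Mathlib

section
/- Let $\bar{n} \in N_T^d$ take exactly $r$ distinct values $g_1 > g_2 > \dots > g_r = 0$, and for $1 \le l \le r$ let $d_l = \#\{i : n_i = g_l\}$ (so $d = d_1 + \dots + d_r$). Then the stabilizer $S_{\bar{n}}$ is finite, of cardinality $|S_{\bar{n}}| = \prod_{l=1}^{r} |GL_{d_l}(\mathbb{F}_q)| \cdot q^{\sum_{1 \le i < j \le r} d_i d_j (g_i - g_j + 1)}$. -/
open Matrix Polynomial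

noncomputable section

/-- `t = X⁻¹` in the Laurent series field `F = 𝔽_q((X))`. -/
def tF (Fq : Type) [Field Fq] : LaurentSeries Fq := HahnSeries.single (-1 : ℤ) (1 : Fq)

/-- The embedding of the polynomial ring `𝔽_q[t]` into `F = 𝔽_q((X))`, sending the
polynomial variable to `t = X⁻¹`. -/
def polyToF (Fq : Type) [Field Fq] : Polynomial Fq →+* LaurentSeries Fq :=
  Polynomial.eval₂RingHom (HahnSeries.C) (tF Fq)

/-- The lattice `l_n̄ = t^{n₁}𝒪e₁ ⊕ ⋯ ⊕ t^{n_d}𝒪e_d` as an `𝒪`-submodule of `F^d`,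
where `𝒪 = 𝔽_q[[X]]` acts on `F = 𝔽_q((X))` via the inclusion, and
`t^{n} = HahnSeries.single (-n) 1`. -/
def lattM (Fq : Type) [Field Fq] {d : ℕ} (n : Fin d → ℤ) :
    Submodule (PowerSeries Fq) (Fin d → LaurentSeries Fq) :=
  Submodule.span (PowerSeries Fq)
    (Set.range fun i : Fin d =>
      (HahnSeries.single (-(n i)) (1 : Fq) : LaurentSeries Fq) •
        (Pi.single i (1 : LaurentSeries Fq) : Fin d → LaurentSeries Fq))

/-- The image `g L` of an `𝒪`-submodule `L ⊆ F^d` under a matrix `g ∈ M_d(F)`. -/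
def actM (Fq : Type) [Field Fq] {d : ℕ} (g : Matrix (Fin d) (Fin d) (LaurentSeries Fq))
    (L : Submodule (PowerSeries Fq) (Fin d → LaurentSeries Fq)) :
    Submodule (PowerSeries Fq) (Fin d → LaurentSeries Fq) :=
  L.map ((g.mulVecLin).restrictScalars (PowerSeries Fq))

/-- The image `a L` of an `𝒪`-submodule `L ⊆ F^d` under scalar multiplication by `a ∈ F`. -/
def scaleM (Fq : Type) [Field Fq] {d : ℕ} (a : LaurentSeries Fq)
    (L : Submodule (PowerSeries Fq) (Fin d → LaurentSeries Fq)) :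
    Submodule (PowerSeries Fq) (Fin d → LaurentSeries Fq) :=
  L.map ((LinearMap.lsmul (LaurentSeries Fq) (Fin d → LaurentSeries Fq) a).restrictScalars
    (PowerSeries Fq))

/-- The image in `M_d(F)` of a matrix over `𝔽_q[t]`. -/
def glToF (Fq : Type) [Field Fq] {d : ℕ} (γ : GL (Fin d) (Polynomial Fq)) :
    Matrix (Fin d) (Fin d) (LaurentSeries Fq) :=
  (γ : Matrix (Fin d) (Fin d) (Polynomial Fq)).map (polyToF Fq)

/-- The stabilizer `S_n̄ = {γ ∈ GL_d(𝔽_q[t]) : γ l_n̄ = l_n̄}`. -/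
def Stab (Fq : Type) [Field Fq] {d : ℕ} (n : Fin d → ℤ) :
    Set (GL (Fin d) (Polynomial Fq)) :=
  {γ | actM Fq (glToF Fq γ) (lattM Fq n) = lattM Fq n}

/-- `N_T^d`: integer tuples `n₁ ≥ n₂ ≥ ⋯ ≥ n_d = 0`. -/
def NT {d : ℕ} (n : Fin d → ℤ) : Prop :=
  (∀ i j : Fin d, i ≤ j → n j ≤ n i) ∧ ∀ i : Fin d, (i : ℕ) = d - 1 → n i = 0

/-- The difference sequence `m_i = n_i - n_{i+1}`. -/
def mdiff {d : ℕ} (n : Fin d → ℤ) (i : ℕ) (h : i + 1 < d) : ℤ :=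
  n ⟨i, Nat.lt_of_succ_lt h⟩ - n ⟨i + 1, h⟩


section

variable {Fq : Type} [Field Fq] {d : ℕ}

theorem coeff_polyToF (p : Fq[X]) (k : ℤ) :
    (polyToF Fq p).coeff k = if 0 < k then 0 else p.coeff k.natAbs := by
  induction p using Polynomial.induction_on' with
  | add p q hp hq =>
    rw [map_add, HahnSeries.coeff_add, hp, hq, Polynomial.coeff_add]
    split_ifs <;> simp
  | monomial m a =>
    have : polyToF Fq (monomial m a) = HahnSeries.single (-(m : ℤ)) a := by
      simp [polyToF, tF, HahnSeries.single_pow, HahnSeries.C_apply, HahnSeries.single_mul_single]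
    rw [this, Polynomial.coeff_monomial]
    split_ifs with hk hm
    · exact HahnSeries.coeff_single_of_ne (by omega)
    · rw [show k = -(m : ℤ) by omega, HahnSeries.coeff_single_same]
    · exact HahnSeries.coeff_single_of_ne (by omega)

theorem exists_eq_coe_mul_single_iff (f : LaurentSeries Fq) (c : ℤ) :
    (∃ p : PowerSeries Fq, f = HahnSeries.ofPowerSeries ℤ Fq p * HahnSeries.single c 1) ↔
      ∀ k < c, f.coeff k = 0 := by
  constructor
  · rintro ⟨p, rfl⟩ k hk
    rw [HahnSeries.coeff_mul_single, mul_one, PowerSeries.coeff_coe, if_pos (by omega)]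
  · intro h
    refine ⟨PowerSeries.mk fun m => f.coeff (m + c), ?_⟩
    ext k
    rw [HahnSeries.coeff_mul_single, mul_one, PowerSeries.coeff_coe]
    split_ifs with hk
    · exact h k (by omega)
    · rw [PowerSeries.coeff_mk]
      congr 1
      omega

theorem powerSeries_smul_def (p : PowerSeries Fq) (f : LaurentSeries Fq) :
    p • f = HahnSeries.ofPowerSeries ℤ Fq p * f :=
  Algebra.smul_def p f

theorem mem_lattM_iff (n : Fin d → ℤ) (v : Fin d → LaurentSeries Fq) :
    v ∈ lattM Fq n ↔ ∀ i, ∀ k < -n i, (v i).coeff k = 0 := by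
  rw [lattM, Submodule.mem_span_range_iff_exists_fun]
  simp_rw [← exists_eq_coe_mul_single_iff]
  rw [Classical.skolem]
  refine exists_congr fun c => ?_
  rw [funext_iff]
  refine forall_congr' fun i => ?_
  rw [Finset.sum_apply, Finset.sum_eq_single i]
  · rw [Pi.smul_apply, powerSeries_smul_def, Pi.smul_apply, Pi.single_eq_same, smul_eq_mul,
      mul_one, eq_comm]
  · intro j _ hj
    rw [Pi.smul_apply, powerSeries_smul_def, Pi.smul_apply, Pi.single_eq_of_ne hj.symm, smul_zero,
      mul_zero]
  · simp

/-- The `(i, j)` entry of `M` has degree at most `n i - n j`. -/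
def DegBound (n : Fin d → ℤ) (M : Matrix (Fin d) (Fin d) Fq[X]) : Prop :=
  ∀ i j, ∀ m : ℕ, n i - n j < m → (M i j).coeff m = 0

theorem DegBound.mul {n : Fin d → ℤ} {M N : Matrix (Fin d) (Fin d) Fq[X]}
    (hM : DegBound n M) (hN : DegBound n N) : DegBound n (M * N) := by
  intro i j m hm
  rw [Matrix.mul_apply, Polynomial.finsetSum_coeff]
  refine Finset.sum_eq_zero fun k _ => ?_
  rw [Polynomial.coeff_mul]
  refine Finset.sum_eq_zero fun ⟨a, b⟩ hab => ?_
  rw [Finset.HasAntidiagonal.mem_antidiagonal] at hab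
  rcases lt_or_ge (n i - n k) a with h | h
  · rw [hM i k a h, zero_mul]
  · rw [hN k j b (by push_cast [← hab] at hm; linarith), mul_zero]

theorem DegBound.one (n : Fin d → ℤ) :
    DegBound n (1 : Matrix (Fin d) (Fin d) Fq[X]) := by
  intro i j m hm
  rw [Matrix.one_apply]
  split_ifs with h
  · subst h
    rw [Polynomial.coeff_one, if_neg (by omega)]
  · simp

theorem finite_setOf_degBound [Finite Fq] (n : Fin d → ℤ) :
    {M : Matrix (Fin d) (Fin d) Fq[X] | DegBound n M}.Finite := by
  refine (Set.Finite.pi' (t := fun i => {row : Fin d → Fq[X] | ∀ j,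
    row j ∈ (degreeLT Fq (n i - n j + 1).toNat : Set Fq[X])}) fun i =>
      Set.Finite.pi' fun j => ?_).subset ?_
  · have := Finite.of_equiv _ (degreeLTEquiv Fq (n i - n j + 1).toNat).toEquiv.symm
    exact Set.toFinite _
  · intro M hM i j
    rw [SetLike.mem_coe, mem_degreeLT, degree_lt_iff_coeff_zero]
    exact fun m hm => hM i j m (by omega)

theorem DegBound.inv [Finite Fq] {n : Fin d → ℤ} {γ : GL (Fin d) Fq[X]}
    (h : DegBound n γ.val) : DegBound n (γ⁻¹).val := by
  have hfin := (finite_setOf_degBound (Fq := Fq) n).to_subtype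
  let f : {M : Matrix (Fin d) (Fin d) Fq[X] | DegBound n M} →
      {M : Matrix (Fin d) (Fin d) Fq[X] | DegBound n M} := fun M => ⟨γ.val * M, h.mul M.2⟩
  have hf : Function.Injective f := fun M N hMN =>
    Subtype.ext (γ.isUnit.mul_left_cancel (congrArg Subtype.val hMN))
  obtain ⟨M, hM⟩ := Finite.surjective_of_injective hf ⟨1, DegBound.one n⟩
  have : (γ⁻¹).val = M := by
    rw [Units.inv_eq_of_mul_eq_one_right (congrArg Subtype.val hM)]
  rw [this]
  exact M.2

theorem actM_lattM_le_iff (n : Fin d → ℤ) (γ : GL (Fin d) Fq[X]) :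
    actM Fq (glToF Fq γ) (lattM Fq n) ≤ lattM Fq n ↔ DegBound n γ.val := by
  have entry (i j : Fin d) : (glToF Fq γ *ᵥ
      ((HahnSeries.single (-(n j)) (1 : Fq) : LaurentSeries Fq) •
        (Pi.single j (1 : LaurentSeries Fq) : Fin d → LaurentSeries Fq))) i =
      polyToF Fq (γ.val i j) * HahnSeries.single (-(n j)) 1 := by
    rw [Matrix.mulVec_smul, Matrix.mulVec_single_one, Pi.smul_apply, smul_eq_mul, mul_comm]
    rfl
  rw [actM, Submodule.map_le_iff_le_comap]
  conv_lhs => lhs; rw [lattM]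
  rw [Submodule.span_le, Set.range_subset_iff]
  have mem (j : Fin d) : (HahnSeries.single (-(n j)) (1 : Fq) : LaurentSeries Fq) •
        (Pi.single j (1 : LaurentSeries Fq) : Fin d → LaurentSeries Fq) ∈
        ((lattM Fq n).comap ((glToF Fq γ).mulVecLin.restrictScalars (PowerSeries Fq)) :
          Set (Fin d → LaurentSeries Fq)) ↔
      ∀ i, ∀ m : ℕ, n i - n j < m → (γ.val i j).coeff m = 0 := by
    rw [SetLike.mem_coe, Submodule.mem_comap, LinearMap.restrictScalars_apply,
      Matrix.mulVecLin_apply, mem_lattM_iff]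
    refine forall_congr' fun i => ?_
    rw [entry]
    simp_rw [HahnSeries.coeff_mul_single, mul_one, coeff_polyToF]
    constructor
    · intro h m hm
      have := h (-m - n j) (by omega)
      rwa [if_neg (by omega), show (-(m : ℤ) - n j - -n j).natAbs = m by omega] at this
    · intro h k hk
      split_ifs with h0
      · rfl
      · exact h _ (by omega)
  simp_rw [mem]
  exact forall_comm

theorem actM_actM (A B : Matrix (Fin d) (Fin d) (LaurentSeries Fq))
    (L : Submodule (PowerSeries Fq) (Fin d → LaurentSeries Fq)) :
    actM Fq A (actM Fq B L) = actM Fq (A * B) L := by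
  ext v
  simp [actM]

theorem glToF_mul (γ δ : GL (Fin d) Fq[X]) : glToF Fq (γ * δ) = glToF Fq γ * glToF Fq δ :=
  Matrix.map_mul

theorem mem_stab_iff_degBound [Finite Fq] (n : Fin d → ℤ) (γ : GL (Fin d) Fq[X]) :
    γ ∈ Stab Fq n ↔ DegBound n γ.val := by
  refine ⟨fun h => (actM_lattM_le_iff n γ).1 (le_of_eq h), fun h => ?_⟩
  refine le_antisymm ((actM_lattM_le_iff n γ).2 h) ?_
  have hinv := (actM_lattM_le_iff n γ⁻¹).2 h.inv
  have hid : actM Fq (glToF Fq (γ * γ⁻¹)) (lattM Fq n) = lattM Fq n := by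
    ext v
    simp [actM, glToF]
  rw [glToF_mul, ← actM_actM] at hid
  calc lattM Fq n = actM Fq (glToF Fq γ) (actM Fq (glToF Fq γ⁻¹) (lattM Fq n)) := hid.symm
    _ ≤ _ := Submodule.map_mono hinv

end

section

variable {Fq : Type} [Field Fq] {d r : ℕ}

/-- The block upper triangular matrix with constant diagonal blocks `A l` and entries `u` above
the diagonal blocks, where `b` assigns to each index its block. -/
def blockMatrix (b : Fin d → Fin r) (N : Fin d × Fin d → ℕ)
    (x : (∀ l, GL {a // b a = l} Fq) ×
      (∀ p : {p : Fin d × Fin d // b p.1 < b p.2}, degreeLT Fq (N p))) :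
    Matrix (Fin d) (Fin d) Fq[X] := fun i j =>
  if h : b i = b j then C ((x.1 (b j)).val ⟨i, h⟩ ⟨j, rfl⟩)
  else if h : b i < b j then x.2 ⟨(i, j), h⟩ else 0

variable (b : Fin d → Fin r) (N : Fin d × Fin d → ℕ)

theorem blockMatrix_injective : Function.Injective (blockMatrix (Fq := Fq) b N) := by
  intro x y hxy
  refine Prod.ext (funext fun l => Units.ext (Matrix.ext ?_)) (funext ?_)
  · rintro ⟨i, rfl⟩ ⟨j, hj⟩
    have h := congrFun (congrFun hxy i) j
    have key : ∀ l (hi : b i = l) (hl : b j = l),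
        (x.1 l).val ⟨i, hi⟩ ⟨j, hl⟩ = (y.1 l).val ⟨i, hi⟩ ⟨j, hl⟩ := by
      rintro _ hi rfl
      simpa [blockMatrix, hi] using h
    exact key _ rfl hj
  · rintro ⟨⟨i, j⟩, hp⟩
    have h := congrFun (congrFun hxy i) j
    have hp' : b i < b j := hp
    exact Subtype.ext (by simpa [blockMatrix, hp', hp'.ne] using h)

theorem isUnit_det_iff_of_blockTriangular {M : Matrix (Fin d) (Fin d) Fq[X]}
    (hM : M.BlockTriangular b) {A : ∀ l, Matrix {a // b a = l} {a // b a = l} Fq}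
    (hA : ∀ l, M.toSquareBlock b l = (A l).map C) :
    IsUnit M.det ↔ ∀ l, IsUnit (A l).det := by
  have hdet : M.det = C (∏ l, (A l).det) := by
    rw [hM.det_fintype, map_prod]
    refine Finset.prod_congr rfl fun l _ => ?_
    rw [hA, RingHom.map_det]
    rfl
  rw [hdet, Polynomial.isUnit_C, isUnit_iff_ne_zero, Finset.prod_ne_zero_iff]
  simp

theorem blockMatrix_blockTriangular (x) :
    (blockMatrix (Fq := Fq) b N x).BlockTriangular b := by
  intro i j hij
  rw [blockMatrix, dif_neg hij.ne', dif_neg hij.not_gt]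

theorem blockMatrix_toSquareBlock (x) (l : Fin r) :
    (blockMatrix (Fq := Fq) b N x).toSquareBlock b l = (x.1 l).val.map C := by
  ext1 ⟨i, hi⟩ ⟨j, hj⟩
  subst hj
  simp [Matrix.toSquareBlock_def, blockMatrix, hi]

theorem isUnit_blockMatrix (x) : IsUnit (blockMatrix (Fq := Fq) b N x) := by
  rw [Matrix.isUnit_iff_isUnit_det, isUnit_det_iff_of_blockTriangular b
    (blockMatrix_blockTriangular b N x) (blockMatrix_toSquareBlock b N x)]
  exact fun l => (Matrix.isUnit_iff_isUnit_det _).1 (x.1 l).isUnit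

theorem coeff_blockMatrix_of_lt (x) {i j : Fin d} (h : b i < b j) {m : ℕ} (hm : N (i, j) ≤ m) :
    (blockMatrix (Fq := Fq) b N x i j).coeff m = 0 := by
  have hdeg := mem_degreeLT.1 (x.2 ⟨(i, j), h⟩).2
  rw [blockMatrix, dif_neg h.ne, dif_pos h]
  exact (degree_lt_iff_coeff_zero _ _).1 hdeg m hm

variable {g : Fin r → ℤ} {n : Fin d → ℤ}

theorem range_blockMatrix (hg : StrictAnti g) (hb : ∀ i, g (b i) = n i)
    (hN : ∀ i j, N (i, j) = (n i - n j + 1).toNat) :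
    Set.range (blockMatrix (Fq := Fq) b N) =
      {M | DegBound n M ∧ IsUnit M} := by
  ext M
  constructor
  · rintro ⟨x, rfl⟩
    refine ⟨fun i j m hm => ?_, isUnit_blockMatrix b N x⟩
    rcases lt_trichotomy (b i) (b j) with h | h | h
    · exact coeff_blockMatrix_of_lt b N x h (by rw [hN]; exact Int.toNat_le.2 hm)
    · have : n i = n j := by rw [← hb, ← hb, h]
      rw [blockMatrix, dif_pos h, Polynomial.coeff_C, if_neg (by omega)]
    · rw [blockMatrix_blockTriangular b N x h, Polynomial.coeff_zero]
  · rintro ⟨hM, hu⟩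
    have htri : M.BlockTriangular b := fun i j hij => by
      have := hg hij
      rw [hb, hb] at this
      ext m
      exact hM i j m (by omega)
    let A : ∀ l, Matrix {a // b a = l} {a // b a = l} Fq := fun l =>
      Matrix.of fun i j => (M i j).coeff 0
    have hconst : ∀ i j, b i = b j → M i j = C ((M i j).coeff 0) := fun i j hij => by
      have : n i = n j := by rw [← hb, ← hb, hij]
      ext m
      rw [Polynomial.coeff_C]
      split_ifs with hm
      · rw [hm]
      · exact hM i j m (by omega)
    have hA : ∀ l, M.toSquareBlock b l = (A l).map C := fun l => by
      ext1 i j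
      exact hconst i j (i.2.trans j.2.symm)
    have hAu : ∀ l, IsUnit (A l) := fun l => (Matrix.isUnit_iff_isUnit_det _).2
      ((isUnit_det_iff_of_blockTriangular b htri hA).1
        ((Matrix.isUnit_iff_isUnit_det _).1 hu) l)
    refine ⟨⟨fun l => (hAu l).unit, fun p => ⟨M p.1.1 p.1.2, ?_⟩⟩, ?_⟩
    · rw [mem_degreeLT, degree_lt_iff_coeff_zero]
      exact fun m hm => hM _ _ m (Int.toNat_le.1 (hN _ _ ▸ hm))
    · ext1 i j
      rw [blockMatrix]
      split_ifs with h h'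
      · exact (hconst i j h).symm
      · rfl
      · exact (htri (lt_of_le_of_ne (not_lt.1 h') (Ne.symm h))).symm

theorem image_val_stab [Finite Fq] :
    Units.val '' Stab Fq n = {M | DegBound n M ∧ IsUnit M} := by
  ext M
  constructor
  · rintro ⟨γ, hγ, rfl⟩
    exact ⟨(mem_stab_iff_degBound n γ).1 hγ, γ.isUnit⟩
  · rintro ⟨hM, γ, rfl⟩
    exact ⟨γ, (mem_stab_iff_degBound n γ).2 hM, rfl⟩

theorem natCard_degreeLT [Fintype Fq] (k : ℕ) :
    Nat.card (degreeLT Fq k) = Fintype.card Fq ^ k := by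
  rw [Nat.card_congr (degreeLTEquiv Fq k).toEquiv]
  simp

theorem natCard_GL_congr {ι κ : Type*} [Fintype ι] [DecidableEq ι] [Fintype κ] [DecidableEq κ]
    (e : ι ≃ κ) : Nat.card (GL ι Fq) = Nat.card (GL κ Fq) :=
  Nat.card_congr (Units.mapEquiv (Matrix.reindexAlgEquiv Fq Fq e).toMulEquiv).toEquiv

theorem sum_blocks_above (f : Fin r → Fin r → ℕ) :
    ∑ p : {p : Fin d × Fin d // b p.1 < b p.2}, f (b p.1.1) (b p.1.2) =
      ∑ k, ∑ l, if k < l then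
        (Finset.univ.filter fun i => b i = k).card * (Finset.univ.filter fun i => b i = l).card *
          f k l
      else 0 := by
  rw [← Finset.sum_subtype (Finset.univ.filter fun p : Fin d × Fin d => b p.1 < b p.2) (by simp)
    fun p => f (b p.1) (b p.2), Finset.sum_filter, Fintype.sum_prod_type]
  dsimp only
  rw [← Finset.sum_fiberwise Finset.univ b]
  refine Finset.sum_congr rfl fun k _ => ?_
  have inner (i : Fin d) (hi : i ∈ Finset.univ.filter fun i => b i = k) :
      (∑ j, if b i < b j then f (b i) (b j) else 0) =
        ∑ l, (Finset.univ.filter fun j => b j = l).card * if k < l then f k l else 0 := by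
    rw [(Finset.mem_filter.1 hi).2, ← Finset.sum_fiberwise Finset.univ b]
    refine Finset.sum_congr rfl fun l _ => ?_
    rw [← smul_eq_mul, ← Finset.sum_const]
    exact Finset.sum_congr rfl fun j hj => by rw [(Finset.mem_filter.1 hj).2]
  rw [Finset.sum_congr rfl inner, Finset.sum_const, smul_eq_mul, Finset.mul_sum]
  refine Finset.sum_congr rfl fun l _ => ?_
  split_ifs <;> ring

end

open Matrix Polynomial in
/-- if `n̄ ∈ N_T^d` takes exactly the `r` distinct values `g₁ > ⋯ > g_r = 0`,
with multiplicities `d₁, …, d_r`, then the stabilizer `S_n̄` is finite of cardinality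
`∏_l |GL_{d_l}(𝔽_q)| ⬝ q^{∑_{i<j} d_i d_j (g_i - g_j + 1)}`. -/
theorem card_stabilizer (Fq : Type) [Field Fq] [Fintype Fq]
    (d : ℕ) (hd : 2 ≤ d) (n : Fin d → ℤ) (hn : NT n)
    (r : ℕ) (g : Fin r → ℤ)
    (hg : ∀ i j : Fin r, i < j → g j < g i)
    (hglast : ∀ i : Fin r, (i : ℕ) = r - 1 → g i = 0)
    (hrange : Set.range n = Set.range g)
    (dl : Fin r → ℕ)
    (hdl : ∀ l : Fin r, dl l = (Finset.univ.filter fun i : Fin d => n i = g l).card) :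
    (Stab Fq n).Finite ∧
      Nat.card (Stab Fq n) =
        (∏ l : Fin r, Nat.card (GL (Fin (dl l)) Fq)) *
          (Fintype.card Fq) ^
            (∑ i : Fin r, ∑ j : Fin r,
              if i < j then dl i * dl j * (g i - g j + 1).toNat else 0) := by
  choose b hb using fun i => hrange.le (Set.mem_range_self i)
  have hanti : StrictAnti g := fun i j hij => hg i j hij
  have hcard (l : Fin r) : dl l = (Finset.univ.filter fun i => b i = l).card := by
    rw [hdl]
    simp_rw [← hb, hanti.injective.eq_iff]
  have himage := image_val_stab (Fq := Fq) (n := n)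
  rw [← range_blockMatrix b (fun p => (n p.1 - n p.2 + 1).toNat) hanti hb
    fun _ _ => rfl] at himage
  refine ⟨Set.Finite.of_finite_image
    ((finite_setOf_degBound (Fq := Fq) n).subset ?_) Units.val_injective.injOn, ?_⟩
  · rw [image_val_stab]
    exact fun M hM => hM.1
  rw [← Nat.card_image_of_injective Units.val_injective, himage,
    Nat.card_range_of_injective (blockMatrix_injective b _), Nat.card_prod, Nat.card_pi,
    Nat.card_pi]
  congr 1
  · refine Finset.prod_congr rfl fun l _ => natCard_GL_congr (Fintype.equivFinOfCardEq ?_)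
    rw [hcard, Fintype.card_subtype]
  · simp_rw [natCard_degreeLT, Finset.prod_pow_eq_pow_sum, ← hb, hcard]
    rw [sum_blocks_above b fun k l => (g k - g l + 1).toNat]
end
end

section
/- Every $\mathcal{O}$-lattice $L$ in $F^d$ (i.e. every finitely generated $\mathcal{O}$-submodule of $F^d$ that spans $F^d$ over $F$) can be brought into the fundamental set $T$: there exist $\gamma \in GL_d(\mathbb{F}_q[t])$, $a \in F^{\times}$, and $\bar{n} \in N_T^d$ such that $\gamma L = a\, l_{\bar{n}}$. -/
open Matrix Polynomial

noncomputable section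

variable {Fq : Type} [Field Fq] {d : ℕ}

lemma polyToF_C (c : Fq) : polyToF Fq (C c) = HahnSeries.C c := by
  simp [polyToF]

lemma polyToF_X_pow (k : ℕ) :
    polyToF Fq (X ^ k) = HahnSeries.single (-(k : ℤ)) (1 : Fq) := by
  simp [polyToF, tF, HahnSeries.single_pow]

/-- `A γ = U diag(t^{n₁}, …, t^{n_d})` with `γ ∈ GL_d(𝔽_q[t])` and `U` integral. -/
structure IsColumnScaling (A : Matrix (Fin d) (Fin d) (LaurentSeries Fq))
    (γ : Matrix (Fin d) (Fin d) (Polynomial Fq)) (n : Fin d → ℤ)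
    (U : Matrix (Fin d) (Fin d) (PowerSeries Fq)) : Prop where
  isUnit_det : IsUnit γ.det
  apply_eq : ∀ i j, (A * γ.map (polyToF Fq)) i j =
    algebraMap (PowerSeries Fq) (LaurentSeries Fq) (U i j) * HahnSeries.single (-n j) (1 : Fq)

namespace IsColumnScaling

variable {A : Matrix (Fin d) (Fin d) (LaurentSeries Fq)}
  {γ : Matrix (Fin d) (Fin d) (Polynomial Fq)} {n : Fin d → ℤ}
  {U : Matrix (Fin d) (Fin d) (PowerSeries Fq)}

lemma mul_eq (h : IsColumnScaling A γ n U) :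
    A * γ.map (polyToF Fq) = U.map (algebraMap (PowerSeries Fq) (LaurentSeries Fq)) *
      diagonal fun j => HahnSeries.single (-n j) (1 : Fq) := by
  ext1 i j
  rw [h.apply_eq, mul_diagonal, map_apply]

lemma permute (h : IsColumnScaling A γ n U) (σ : Equiv.Perm (Fin d)) :
    IsColumnScaling A (γ.submatrix id σ) (n ∘ σ) (U.submatrix id σ) where
  isUnit_det := by
    rw [det_permute']
    exact ((Units.isUnit _).map (Int.castRingHom (Polynomial Fq))).mul h.isUnit_det
  apply_eq i j := h.apply_eq i (σ j)

lemma neg_order_det_le_sum (h : IsColumnScaling A γ n U) (hA : A.det ≠ 0) :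
    -(A.det.order) ≤ ∑ j, n j := by
  obtain ⟨c, hc, hcd⟩ := Polynomial.isUnit_iff.1 h.isUnit_det
  have hdet := congrArg det h.mul_eq
  have hprod : (∏ j, HahnSeries.single (-n j) (1 : Fq) : LaurentSeries Fq) =
      HahnSeries.single (-∑ j, n j) 1 := by
    rw [← Finset.sum_neg_distrib]
    induction (Finset.univ : Finset (Fin d)) using Finset.induction_on with
    | empty => rfl
    | insert a s ha ih => rw [Finset.prod_insert ha, Finset.sum_insert ha, ih,
        HahnSeries.single_mul_single, one_mul]
  rw [det_mul, det_mul, det_diagonal, hprod, ← RingHom.mapMatrix_apply, ← RingHom.mapMatrix_apply,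
    ← RingHom.map_det, ← RingHom.map_det, ← hcd, polyToF_C] at hdet
  have hC : (HahnSeries.C c : LaurentSeries Fq) ≠ 0 := HahnSeries.C_ne_zero hc.ne_zero
  have hs : (HahnSeries.single (-∑ j, n j) (1 : Fq) : LaurentSeries Fq) ≠ 0 :=
    HahnSeries.single_ne_zero one_ne_zero
  have hU : algebraMap (PowerSeries Fq) (LaurentSeries Fq) U.det ≠ 0 := by
    intro h0
    rw [h0, zero_mul] at hdet
    exact mul_ne_zero hA hC hdet
  have hord := congrArg HahnSeries.order hdet
  rw [HahnSeries.order_mul hA hC, HahnSeries.order_mul hU hs, HahnSeries.order_C,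
    HahnSeries.order_single one_ne_zero] at hord
  have hnonneg : 0 ≤ (algebraMap (PowerSeries Fq) (LaurentSeries Fq) U.det).order := by
    by_contra! hlt
    refine hU (HahnSeries.coeff_order_eq_zero.1 ?_)
    rw [LaurentSeries.coe_algebraMap]
    rw [LaurentSeries.coe_algebraMap] at hlt
    rw [PowerSeries.coeff_coe, if_pos hlt]
  linarith

lemma exists_sum_lt (h : IsColumnScaling A γ n U) (hU : ¬ IsUnit U.det) :
    ∃ γ' n' U', IsColumnScaling A γ' n' U' ∧ ∑ j, n' j < ∑ j, n j := by
  have hU0 : (U.map (PowerSeries.constantCoeff (R := Fq))).det = 0 := by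
    rw [← RingHom.mapMatrix_apply, ← RingHom.map_det]
    by_contra hne
    exact hU (PowerSeries.isUnit_iff_constantCoeff.2 (isUnit_iff_ne_zero.2 hne))
  obtain ⟨c, hc0, hc⟩ := exists_mulVec_eq_zero_iff.2 hU0
  obtain ⟨j, hj, hmax⟩ : ∃ j, c j ≠ 0 ∧ ∀ k, c k ≠ 0 → n k ≤ n j := by
    obtain ⟨k, hk⟩ := Function.ne_iff.1 hc0
    classical
    obtain ⟨j, hj, hmax⟩ := (Finset.univ.filter fun k => c k ≠ 0).exists_max_image n
      ⟨k, by simpa using hk⟩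
    exact ⟨j, by simpa using hj, fun k hk => hmax k (by simpa using hk)⟩
  have hdvd : ∀ i, ∃ w : PowerSeries Fq,
      ∑ k, U i k * PowerSeries.C (c k) = PowerSeries.X * w := by
    intro i
    refine PowerSeries.X_dvd_iff.2 ?_
    simpa [mulVec, dotProduct] using congrFun hc i
  choose w hw using hdvd
  set v : Fin d → Polynomial Fq := fun k => C (c k) * X ^ (n j - n k).toNat with hv
  have hvF (k : Fin d) : HahnSeries.single (-n k) (1 : Fq) * polyToF Fq (v k) =
      HahnSeries.C (c k) * HahnSeries.single (-n j) (1 : Fq) := by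
    by_cases hk : c k = 0
    · simp [hv, hk]
    · rw [hv, map_mul, polyToF_C, polyToF_X_pow, mul_left_comm, HahnSeries.single_mul_single,
        one_mul, Int.toNat_of_nonneg (sub_nonneg.2 (hmax k hk))]
      ring_nf
  refine ⟨γ * (1 : Matrix _ _ _).updateCol j v, Function.update n j (n j - 1), U.updateCol j w,
    ⟨?_, ?_⟩, ?_⟩
  · rw [det_mul, ← cramer_apply, cramer_one]
    refine h.isUnit_det.mul ?_
    simpa [hv] using hj
  · intro i k
    rw [← RingHom.mapMatrix_apply, map_mul, RingHom.mapMatrix_apply, RingHom.mapMatrix_apply,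
      ← Matrix.mul_assoc, Matrix.mul_apply]
    by_cases hk : k = j
    · subst hk
      simp only [map_apply, updateCol_self, h.apply_eq, mul_assoc, hvF, Function.update_self]
      simp only [← mul_assoc]
      rw [← Finset.sum_mul]
      have := congrArg (algebraMap (PowerSeries Fq) (LaurentSeries Fq)) (hw i)
      simp only [map_sum, map_mul, LaurentSeries.coe_algebraMap, HahnSeries.ofPowerSeries_C,
        HahnSeries.ofPowerSeries_X] at this ⊢
      rw [this, mul_comm (HahnSeries.single (1 : ℤ) (1 : Fq)), mul_assoc,
        HahnSeries.single_mul_single, one_mul]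
      ring_nf
    · simp only [map_apply, updateCol_ne hk, h.apply_eq, Function.update_of_ne hk]
      rw [Finset.sum_eq_single k]
      · simp
      · intro b _ hb
        simp [one_apply_ne hb]
      · simp
  · refine Finset.sum_lt_sum (fun k _ => ?_) ⟨j, Finset.mem_univ j, by simp⟩
    by_cases hk : k = j
    · subst hk; simp
    · simp [Function.update_of_ne hk]

lemma exists_one (A : Matrix (Fin d) (Fin d) (LaurentSeries Fq)) :
    ∃ n U, IsColumnScaling A 1 n U := by
  have hcol : ∀ j, ∃ m : ℤ, ∀ i, m ≤ (A i j).order := fun j => by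
    obtain ⟨m, hm⟩ := (Set.finite_range fun i => (A i j).order).bddBelow
    exact ⟨m, fun i => hm ⟨i, rfl⟩⟩
  choose m hm using hcol
  have hU : ∀ i j, ∃ u : PowerSeries Fq, A i j =
      algebraMap (PowerSeries Fq) (LaurentSeries Fq) u * HahnSeries.single (m j) (1 : Fq) := by
    intro i j
    refine ⟨PowerSeries.X ^ ((A i j).order - m j).toNat * (A i j).powerSeriesPart, ?_⟩
    rw [map_mul, LaurentSeries.coe_algebraMap, HahnSeries.ofPowerSeries_X_pow, mul_right_comm,
      HahnSeries.single_mul_single, Int.toNat_of_nonneg (sub_nonneg.2 (hm j i)), sub_add_cancel,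
      one_mul]
    exact (LaurentSeries.single_order_mul_powerSeriesPart (A i j)).symm
  choose U hU using hU
  refine ⟨fun j => -m j, U, by simp, fun i j => ?_⟩
  simpa [Matrix.map_one] using hU i j

/-- Reduction theory: some `γ ∈ GL_d(𝔽_q[t])` makes `A γ` equal to `U diag(t^n)` with
`U ∈ GL_d(𝒪)`. -/
lemma exists_isUnit_det (hA : A.det ≠ 0) :
    ∃ γ n U, IsColumnScaling A γ n U ∧ IsUnit U.det := by
  obtain ⟨s, ⟨γ, n, U, h, rfl⟩, hmin⟩ := Int.exists_least_of_bdd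
    (P := fun s => ∃ γ n U, IsColumnScaling A γ n U ∧ ∑ j, n j = s)
    ⟨-(A.det.order), by rintro _ ⟨γ, n, U, h, rfl⟩; exact h.neg_order_det_le_sum hA⟩
    (by obtain ⟨n, U, h⟩ := exists_one A; exact ⟨_, 1, n, U, h, rfl⟩)
  refine ⟨γ, n, U, h, ?_⟩
  by_contra hU
  obtain ⟨γ', n', U', h', hlt⟩ := h.exists_sum_lt hU
  exact (hmin _ ⟨γ', n', U', h', rfl⟩).not_gt hlt

end IsColumnScaling

variable (Fq) in
/-- The `𝒪`-submodule of `F^d` spanned by the columns of a matrix. -/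
def colSpan (M : Matrix (Fin d) (Fin d) (LaurentSeries Fq)) :
    Submodule (PowerSeries Fq) (Fin d → LaurentSeries Fq) :=
  Submodule.span (PowerSeries Fq) (Set.range M.col)

lemma actM_colSpan (g M : Matrix (Fin d) (Fin d) (LaurentSeries Fq)) :
    actM Fq g (colSpan Fq M) = colSpan Fq (g * M) := by
  rw [actM, colSpan, Submodule.map_span, ← Set.range_comp]
  rfl

lemma colSpan_mul_le (M : Matrix (Fin d) (Fin d) (LaurentSeries Fq))
    (V : Matrix (Fin d) (Fin d) (PowerSeries Fq)) :
    colSpan Fq (M * V.map (algebraMap (PowerSeries Fq) (LaurentSeries Fq))) ≤ colSpan Fq M := by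
  refine Submodule.span_le.2 ?_
  rintro _ ⟨j, rfl⟩
  have : (M * V.map (algebraMap (PowerSeries Fq) (LaurentSeries Fq))).col j =
      ∑ k, V k j • M.col k := by
    ext1 i
    simp [Matrix.mul_apply, Algebra.smul_def, mul_comm]
  rw [this]
  exact Submodule.sum_mem _ fun k _ =>
    Submodule.smul_mem _ _ (Submodule.subset_span ⟨k, rfl⟩)

lemma colSpan_mul_of_isUnit_det (M : Matrix (Fin d) (Fin d) (LaurentSeries Fq))
    {V : Matrix (Fin d) (Fin d) (PowerSeries Fq)} (hV : IsUnit V.det) :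
    colSpan Fq (M * V.map (algebraMap (PowerSeries Fq) (LaurentSeries Fq))) = colSpan Fq M := by
  refine (colSpan_mul_le M V).antisymm ?_
  have := colSpan_mul_le (M * V.map (algebraMap (PowerSeries Fq) (LaurentSeries Fq))) V⁻¹
  rwa [Matrix.mul_assoc, ← Matrix.map_mul, Matrix.mul_nonsing_inv _ hV,
    Matrix.map_one _ (map_zero _) (map_one _), Matrix.mul_one] at this

lemma scaleM_lattM (a : LaurentSeries Fq) (n : Fin d → ℤ) :
    scaleM Fq a (lattM Fq n) =
      colSpan Fq (diagonal fun j => a * HahnSeries.single (-n j) (1 : Fq)) := by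
  rw [scaleM, lattM, Submodule.map_span, ← Set.range_comp, colSpan]
  congr 2
  ext1 j
  ext1 i
  by_cases hij : i = j
  · subst hij; simp [mul_comm]
  · simp [hij]

lemma exists_eq_colSpan {L : Submodule (PowerSeries Fq) (Fin d → LaurentSeries Fq)}
    (hFG : L.FG)
    (hspan : Submodule.span (LaurentSeries Fq) (L : Set (Fin d → LaurentSeries Fq)) = ⊤) :
    ∃ B : Matrix (Fin d) (Fin d) (LaurentSeries Fq), IsUnit B.det ∧ L = colSpan Fq B := by
  have : Submodule.IsLattice (LaurentSeries Fq) L := ⟨hFG, hspan⟩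
  have := Submodule.IsLattice.free (LaurentSeries Fq) L
  let b : Module.Basis (Fin d) (PowerSeries Fq) L := Module.finBasisOfFinrankEq _ _
    (by rw [Submodule.IsLattice.finrank_of_pi (LaurentSeries Fq) L, Fintype.card_fin])
  let B : Matrix (Fin d) (Fin d) (LaurentSeries Fq) := of fun i j => (b j).val i
  refine ⟨B, ?_, ?_⟩
  · rw [← isUnit_iff_isUnit_det, ← Matrix.linearIndependent_cols_iff_isUnit]
    have h := (b.extendOfIsLattice (LaurentSeries Fq)).linearIndependent
    have hB : B.col = b.extendOfIsLattice (LaurentSeries Fq) := by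
      ext1 j
      rw [Module.Basis.extendOfIsLattice_apply]
      rfl
    rwa [hB]
  · have h := congrArg (Submodule.map L.subtype) b.span_eq
    rw [Submodule.map_span, ← Set.range_comp, Submodule.map_top, Submodule.range_subtype] at h
    exact h.symm

end

open Matrix Polynomial in
/-- every `𝒪`-lattice `L` in `F^d` (finitely generated `𝒪`-submodule spanning
`F^d` over `F`) can be brought into the fundamental set `T`: there are `γ ∈ GL_d(𝔽_q[t])`,
`a ∈ F^×` and `n̄ ∈ N_T^d` with `γ L = a l_n̄`. -/
theorem lattice_to_fundamental_domain (Fq : Type) [Field Fq] [Fintype Fq]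
    (d : ℕ) (hd : 2 ≤ d)
    (L : Submodule (PowerSeries Fq) (Fin d → LaurentSeries Fq))
    (hFG : L.FG)
    (hspan : Submodule.span (LaurentSeries Fq) (L : Set (Fin d → LaurentSeries Fq)) = ⊤) :
    ∃ (γ : GL (Fin d) (Polynomial Fq)) (a : LaurentSeries Fq) (n : Fin d → ℤ),
      a ≠ 0 ∧ NT n ∧ actM Fq (glToF Fq γ) L = scaleM Fq a (lattM Fq n) := by
  obtain ⟨B, hB, rfl⟩ := exists_eq_colSpan hFG hspan
  obtain ⟨γ₀, n₀, U₀, h₀, hU₀⟩ := IsColumnScaling.exists_isUnit_det (A := B⁻¹)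
    (B.isUnit_nonsing_inv_det hB).ne_zero
  have h := h₀.permute (Tuple.sort n₀)
  have hmono : Monotone (n₀ ∘ Tuple.sort n₀) := Tuple.monotone_sort n₀
  have hU : IsUnit (U₀.submatrix id (Tuple.sort n₀)).det := by
    rw [det_permute']
    exact ((Units.isUnit _).map (Int.castRingHom (PowerSeries Fq))).mul hU₀
  generalize γ₀.submatrix id (Tuple.sort n₀) = γ at h
  generalize n₀ ∘ Tuple.sort n₀ = n at h hmono
  generalize U₀.submatrix id (Tuple.sort n₀) = U at h hU
  let last : Fin d := ⟨d - 1, by omega⟩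
  refine ⟨(GeneralLinearGroup.mk'' γ h.isUnit_det)⁻¹, HahnSeries.single (n last) 1,
    fun j => n last - n j, HahnSeries.single_ne_zero one_ne_zero,
    ⟨fun i j hij => sub_le_sub_left (hmono hij) _, fun i hi => ?_⟩, ?_⟩
  · rw [show i = last from Fin.ext hi]
    exact sub_self _
  have hγ : glToF Fq (GeneralLinearGroup.mk'' γ h.isUnit_det)⁻¹ * γ.map (polyToF Fq) = 1 := by
    rw [glToF, ← Matrix.map_mul]
    have : ((GeneralLinearGroup.mk'' γ h.isUnit_det)⁻¹ : GL (Fin d) (Polynomial Fq)).val * γ = 1 :=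
      Units.inv_mul (GeneralLinearGroup.mk'' γ h.isUnit_det)
    rw [this, Matrix.map_one _ (map_zero _) (map_one _)]
  generalize glToF Fq (GeneralLinearGroup.mk'' γ h.isUnit_det)⁻¹ = g at hγ
  have hinv : (diagonal fun j => HahnSeries.single (-n j) (1 : Fq)) *
      (diagonal fun j => HahnSeries.single (n j) (1 : Fq)) =
        (1 : Matrix (Fin d) (Fin d) (LaurentSeries Fq)) := by
    rw [diagonal_mul_diagonal, ← diagonal_one]
    congr 1
    ext1 j
    rw [HahnSeries.single_mul_single, neg_add_cancel, one_mul]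
    rfl
  have key : g * B * U.map (algebraMap (PowerSeries Fq) (LaurentSeries Fq)) =
      diagonal fun j => HahnSeries.single (n j) (1 : Fq) := by
    calc _ = g * B * (U.map (algebraMap (PowerSeries Fq) (LaurentSeries Fq)) *
          (diagonal fun j => HahnSeries.single (-n j) (1 : Fq))) *
          (diagonal fun j => HahnSeries.single (n j) (1 : Fq)) := by
          rw [← Matrix.mul_assoc, Matrix.mul_assoc _ (diagonal _), hinv, Matrix.mul_one]
      _ = g * (B * B⁻¹) * γ.map (polyToF Fq) *
          (diagonal fun j => HahnSeries.single (n j) (1 : Fq)) := by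
          rw [← h.mul_eq]; simp only [Matrix.mul_assoc]
      _ = _ := by rw [mul_nonsing_inv _ hB, Matrix.mul_one, hγ, Matrix.one_mul]
  rw [actM_colSpan, ← colSpan_mul_of_isUnit_det _ hU, key, scaleM_lattM]
  congr 2
  ext1 j
  rw [HahnSeries.single_mul_single, one_mul]
  ring_nf
end
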